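/- arXiv:1712.05340 — 2 statements merged into one kernel-verified Lean document; each statement's English description precedes it below -/
import Mathlib

section
/- Let θ be a primitive random substitution with nonempty RS-subshift X_θ. Then the union of all substitutive subspaces of X_θ is a dense subset of X_θ. -/
namespace RS

variable {A : Type*} {V : Type*}

/-- The set of realisations of a random substitution applied (once) to a word. -/
def real (θ : A → Set (List A)) : List A → Set (List A)
  | [] => {[]}
  | a :: w => {u | ∃ v ∈ θ a, ∃ r ∈ real θ w, u = v ++ r}

/-- The set of realisations of the `k`-th power of a random substitution on a word. -/
def realPow (θ : A → Set (List A)) : ℕ → List A → Set (List A)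
  | 0, w => {w}
  | k + 1, w => ⋃ v ∈ real θ w, realPow θ k v

/-- `θ` is a random substitution: each letter has a nonempty finite set of
nonempty realisations. -/
def IsRandomSubst (θ : A → Set (List A)) : Prop :=
  ∀ a, (θ a).Nonempty ∧ (θ a).Finite ∧ ∀ u ∈ θ a, u ≠ []

/-- Primitivity of a random substitution. -/
def Primitive (θ : A → Set (List A)) : Prop :=
  ∃ k : ℕ, ∀ a b : A, ∃ v ∈ realPow θ k [b], a ∈ v

/-- `θ`-legal words. -/
def Legal (θ : A → Set (List A)) (u : List A) : Prop :=
  ∃ (k : ℕ) (a : A) (v : List A), v ∈ realPow θ k [a] ∧ u <:+: v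

/-- The subword of a bi-infinite sequence starting at `i` of length `n`. -/
def subwordAt (x : ℤ → A) (i : ℤ) (n : ℕ) : List A :=
  List.ofFn fun j : Fin n => x (i + (j : ℤ))

/-- The RS-subshift of a random substitution. -/
def X (θ : A → Set (List A)) : Set (ℤ → A) :=
  {x | ∀ (i : ℤ) (n : ℕ), Legal θ (subwordAt x i n)}

/-- The left shift on bi-infinite sequences. -/
def shift (x : ℤ → A) : ℤ → A := fun i => x (i + 1)

/-- The words of length `n` in the language of a subshift. -/
def lang (Y : Set (ℤ → A)) (n : ℕ) : Set (List A) :=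
  {u | u.length = n ∧ ∃ x ∈ Y, ∃ i : ℤ, u = subwordAt x i n}

/-- Topological entropy of a subshift. -/
noncomputable def entropy (Y : Set (ℤ → A)) : ℝ :=
  Filter.limsup (fun n : ℕ => Real.log ((lang Y n).ncard) / n) Filter.atTop

/-- Source of a list of edges. -/
def src (γ : List (V × V)) : Option V := γ.head?.map Prod.fst

/-- Target of a list of edges. -/
def tgt (γ : List (V × V)) : Option V := γ.getLast?.map Prod.snd

/-- A (nonempty) path in the directed graph with edge set `E`. -/
def IsPath (E : Set (V × V)) (γ : List (V × V)) : Prop :=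
  γ ≠ [] ∧ (∀ e ∈ γ, e ∈ E) ∧ γ.Chain' fun e f => e.2 = f.1

/-- A cycle: a path whose source equals its target. -/
def IsCycle (E : Set (V × V)) (γ : List (V × V)) : Prop :=
  IsPath E γ ∧ src γ = tgt γ

/-- A simple path/cycle: the sources of its edges are pairwise distinct. -/
def IsSimple (γ : List (V × V)) : Prop := (γ.map Prod.fst).Nodup

/-- Strong connectivity. -/
def StronglyConnected (E : Set (V × V)) : Prop :=
  ∀ v w : V, ∃ γ : List (V × V), IsPath E γ ∧ src γ = some v ∧ tgt γ = some w

/-- The word read of a cycle: the sources of its edges followed by its root. -/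
def wordRead (γ : List (V × V)) : List V :=
  γ.map Prod.fst ++ (src γ).toList

/-- The cycle-substitution associated with the graph on the alphabet `A`
with edge set `E`. -/
def cycleSubst (E : Set (A × A)) (a : A) : Set (List A) :=
  {[a]} ∪ {u | ∃ γ : List (A × A), IsCycle E γ ∧ IsSimple γ ∧ src γ = some a ∧ u = wordRead γ}

/-- The word `w` applied under a deterministic substitution `φ`. -/
def detApply (φ : A → List A) (w : List A) : List A := (w.map φ).flatten

/-- Primitivity of a deterministic substitution. -/
def DetPrimitive (φ : A → List A) : Prop :=
  ∃ k : ℕ, ∀ a b : A, b ∈ (detApply φ)^[k] [a]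

/-- The subshift of a deterministic substitution. -/
def Xdet (φ : A → List A) : Set (ℤ → A) :=
  {x | ∀ (i : ℤ) (n : ℕ), ∃ (k : ℕ) (a : A), subwordAt x i n <:+: (detApply φ)^[k] [a]}

/-- Substitutive subshifts. -/
def Substitutive (Y : Set (ℤ → A)) : Prop :=
  ∃ φ : A → List A, (∀ a, φ a ≠ []) ∧ DetPrimitive φ ∧ Y = Xdet φ

/-- A factor map between subshifts. -/
def IsFactorMap {A B : Type*} [TopologicalSpace A] [TopologicalSpace B]
    (Y : Set (ℤ → A)) (Z : Set (ℤ → B)) (f : Y → Z) : Prop :=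
  Continuous f ∧ Function.Surjective f ∧
    ∀ (x : ℤ → A) (hx : x ∈ Y) (hx' : shift x ∈ Y),
      ((f ⟨shift x, hx'⟩ : Z) : ℤ → B) = shift ((f ⟨x, hx⟩ : Z) : ℤ → B)

section Realisations

variable {θ : A → Set (List A)}

theorem real_append {u v w₁ w₂ : List A} (hu : u ∈ real θ w₁) (hv : v ∈ real θ w₂) :
    u ++ v ∈ real θ (w₁ ++ w₂) := by
  induction w₁ generalizing u with
  | nil =>
    obtain rfl : u = [] := hu
    exact hv
  | cons a w ih =>
    obtain ⟨x, hx, r, hr, rfl⟩ := hu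
    exact ⟨x, hx, r ++ v, ih hr, List.append_assoc _ _ _⟩

theorem realPow_append {n : ℕ} {u v w₁ w₂ : List A} (hu : u ∈ realPow θ n w₁)
    (hv : v ∈ realPow θ n w₂) : u ++ v ∈ realPow θ n (w₁ ++ w₂) := by
  induction n generalizing w₁ w₂ with
  | zero =>
    obtain rfl : u = w₁ := hu
    obtain rfl : v = w₂ := hv
    rfl
  | succ n ih =>
    simp only [realPow, Set.mem_iUnion] at hu hv ⊢
    obtain ⟨x, hx, hu⟩ := hu
    obtain ⟨y, hy, hv⟩ := hv
    exact ⟨x ++ y, real_append hx hy, ih hu hv⟩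

theorem realPow_add {m n : ℕ} {u v w : List A} (hv : v ∈ realPow θ m w)
    (hu : u ∈ realPow θ n v) : u ∈ realPow θ (m + n) w := by
  induction m generalizing w with
  | zero =>
    obtain rfl : v = w := hv
    rwa [Nat.zero_add]
  | succ m ih =>
    rw [Nat.succ_add]
    simp only [realPow, Set.mem_iUnion] at hv ⊢
    obtain ⟨x, hx, hv⟩ := hv
    exact ⟨x, hx, ih hv⟩

theorem real_subset_realPow_one {w : List A} : real θ w ⊆ realPow θ 1 w := fun v hv =>
  Set.mem_iUnion₂.2 ⟨v, hv, rfl⟩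

theorem nil_mem_realPow (n : ℕ) : ([] : List A) ∈ realPow θ n [] := by
  induction n with
  | zero => rfl
  | succ n ih => exact Set.mem_iUnion₂.2 ⟨[], rfl, ih⟩

theorem mem_real_singleton {a : A} {v : List A} : v ∈ real θ [a] ↔ v ∈ θ a := by
  simp [real]

theorem IsRandomSubst.real_nonempty (hθ : IsRandomSubst θ) (w : List A) :
    (real θ w).Nonempty := by
  induction w with
  | nil => exact ⟨[], rfl⟩
  | cons a w ih =>
    obtain ⟨v, hv⟩ := (hθ a).1
    obtain ⟨r, hr⟩ := ih
    exact ⟨v ++ r, v, hv, r, hr, rfl⟩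

theorem IsRandomSubst.realPow_nonempty (hθ : IsRandomSubst θ) (n : ℕ) (w : List A) :
    (realPow θ n w).Nonempty := by
  induction n generalizing w with
  | zero => exact ⟨w, rfl⟩
  | succ n ih =>
    obtain ⟨v, hv⟩ := hθ.real_nonempty w
    obtain ⟨u, hu⟩ := ih v
    exact ⟨u, Set.mem_iUnion₂.2 ⟨v, hv, hu⟩⟩

theorem IsRandomSubst.length_le_of_mem_real (hθ : IsRandomSubst θ) {v w : List A}
    (hv : v ∈ real θ w) : w.length ≤ v.length := by
  induction w generalizing v with
  | nil => exact Nat.zero_le _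
  | cons a w ih =>
    obtain ⟨x, hx, r, hr, rfl⟩ := hv
    have hpos := List.length_pos_of_ne_nil ((hθ a).2.2 x hx)
    have := ih hr
    simp only [List.length_cons, List.length_append]
    omega

theorem IsRandomSubst.length_le_of_mem_realPow (hθ : IsRandomSubst θ) {n : ℕ} {v w : List A}
    (hv : v ∈ realPow θ n w) : w.length ≤ v.length := by
  induction n generalizing w with
  | zero =>
    obtain rfl : v = w := hv
    exact le_rfl
  | succ n ih =>
    obtain ⟨x, hx, hv⟩ := Set.mem_iUnion₂.1 hv
    exact (hθ.length_le_of_mem_real hx).trans (ih hv)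

theorem IsRandomSubst.ne_nil_of_mem_realPow (hθ : IsRandomSubst θ) {n : ℕ} {v : List A} {a : A}
    (hv : v ∈ realPow θ n [a]) : v ≠ [] :=
  List.ne_nil_of_length_pos (hθ.length_le_of_mem_realPow hv)

/-- A realisation on a letter of a word extends to a realisation on the whole word. -/
theorem IsRandomSubst.exists_infix_of_mem (hθ : IsRandomSubst θ) {n : ℕ} {a : A} {v w : List A}
    (ha : a ∈ w) (hv : v ∈ realPow θ n [a]) : ∃ u ∈ realPow θ n w, v <:+: u := by
  obtain ⟨s, t, rfl⟩ := List.append_of_mem ha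
  obtain ⟨x, hx⟩ := hθ.realPow_nonempty n s
  obtain ⟨y, hy⟩ := hθ.realPow_nonempty n t
  refine ⟨x ++ (v ++ y), realPow_append hx ?_, x, y, List.append_assoc _ _ _⟩
  exact realPow_append (w₁ := [a]) hv hy

theorem length_le_of_mem_real_of_length_le_one (h : ∀ a, ∀ v ∈ θ a, v.length ≤ 1) {v w : List A}
    (hv : v ∈ real θ w) : v.length ≤ w.length := by
  induction w generalizing v with
  | nil =>
    obtain rfl : v = [] := hv
    exact le_rfl
  | cons a w ih =>
    obtain ⟨x, hx, r, hr, rfl⟩ := hv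
    have hle := h a x hx
    have := ih hr
    simp only [List.length_cons, List.length_append]
    omega

theorem length_le_of_mem_realPow_of_length_le_one (h : ∀ a, ∀ v ∈ θ a, v.length ≤ 1) {n : ℕ}
    {v w : List A} (hv : v ∈ realPow θ n w) : v.length ≤ w.length := by
  induction n generalizing w with
  | zero =>
    obtain rfl : v = w := hv
    exact le_rfl
  | succ n ih =>
    obtain ⟨x, hx, hv⟩ := Set.mem_iUnion₂.1 hv
    exact (ih hv).trans (length_le_of_mem_real_of_length_le_one h hx)

theorem exists_two_le_length_of_X_nonempty (hne : (X θ).Nonempty) :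
    ∃ a, ∃ v ∈ θ a, 2 ≤ v.length := by
  by_contra! h
  obtain ⟨x, hx⟩ := hne
  obtain ⟨k, a, v, hv, huv⟩ := hx 0 2
  have h₁ := length_le_of_mem_realPow_of_length_le_one
    (fun a v hv => Nat.le_of_lt_succ (h a v hv)) hv
  have h₂ := huv.length_le
  simp only [subwordAt, List.length_ofFn, List.length_singleton] at h₁ h₂
  omega

/-- If the RS-subshift is nonempty, some power of a primitive random substitution has
arbitrarily long realisations, simultaneously on all letters. -/
theorem IsRandomSubst.exists_realPow_length_ge (hθ : IsRandomSubst θ) (hprim : Primitive θ)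
    (hne : (X θ).Nonempty) (L : ℕ) : ∃ n, ∀ b, ∃ v ∈ realPow θ n [b], L ≤ v.length := by
  obtain ⟨k, hk⟩ := hprim
  obtain ⟨d, vd, hvd, hlen⟩ := exists_two_le_length_of_X_nonempty hne
  induction L with
  | zero => exact ⟨0, fun b => ⟨[b], rfl, Nat.zero_le _⟩⟩
  | succ L ih =>
    obtain ⟨n, hn⟩ := ih
    refine ⟨n + (k + 1), fun b => ?_⟩
    obtain ⟨v, hv, hL⟩ := hn b
    obtain ⟨c, v, rfl⟩ := List.exists_cons_of_ne_nil (hθ.ne_nil_of_mem_realPow hv)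
    obtain ⟨y, hy, hdy⟩ := hk d c
    obtain ⟨y', hy', hinf⟩ :=
      hθ.exists_infix_of_mem hdy (real_subset_realPow_one (mem_real_singleton.2 hvd))
    obtain ⟨z, hz⟩ := hθ.realPow_nonempty (k + 1) v
    refine ⟨y' ++ z, realPow_add hv (realPow_append (w₁ := [c]) (realPow_add hy hy') hz), ?_⟩
    have h₁ := hinf.length_le
    have h₂ := hθ.length_le_of_mem_realPow hz
    simp only [List.length_cons, List.length_append] at hL ⊢
    omega

theorem IsRandomSubst.exists_forall_infix_realPow (hθ : IsRandomSubst θ) {n : ℕ} {ts : List (List A)}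
    {w : List A} (hts : ∀ t ∈ ts, ∀ b, ∃ u ∈ realPow θ n [b], t <:+: u)
    (hlen : ts.length ≤ w.length) : ∃ u ∈ realPow θ n w, ∀ t ∈ ts, t <:+: u := by
  induction ts generalizing w with
  | nil =>
    obtain ⟨u, hu⟩ := hθ.realPow_nonempty n w
    exact ⟨u, hu, by simp⟩
  | cons t ts ih =>
    cases w with
    | nil => simp at hlen
    | cons a w =>
      obtain ⟨x, hx, htx⟩ := hts t List.mem_cons_self a
      obtain ⟨u, hu, hus⟩ := ih (fun t ht => hts t (List.mem_cons_of_mem _ ht))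
        (Nat.le_of_succ_le_succ hlen)
      refine ⟨x ++ u, realPow_append (w₁ := [a]) hx hu, fun t' ht' => ?_⟩
      rcases List.mem_cons.1 ht' with rfl | ht'
      · exact htx.trans (List.prefix_append _ _).isInfix
      · exact (hus t' ht').trans (List.suffix_append _ _).isInfix

/-- A legal word occurs, in the interior and together with every letter, in a realisation of a
fixed power on each letter. -/
theorem IsRandomSubst.exists_realPow_interior [Finite A] (hθ : IsRandomSubst θ)
    (hprim : Primitive θ) (hne : (X θ).Nonempty) {u : List A} (hu : Legal θ u) :
    ∃ n, ∀ b, ∃ p m s : List A, p ++ m ++ s ∈ realPow θ n [b] ∧ p ≠ [] ∧ s ≠ [] ∧ u <:+: m ∧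
      ∀ c, c ∈ m := by
  have := Fintype.ofFinite A
  obtain ⟨k, hk⟩ := id hprim
  obtain ⟨j, a, v, hv, huv⟩ := hu
  set ts : List (List A) := u :: (Finset.univ : Finset A).toList.map fun c => [c] with hts
  have hocc : ∀ t ∈ ts, ∀ b, ∃ w ∈ realPow θ (k + j) [b], t <:+: w := by
    intro t ht b
    simp only [hts, List.mem_cons, List.mem_map, Finset.mem_toList, Finset.mem_univ,
      true_and] at ht
    rcases ht with rfl | ⟨c, rfl⟩
    · obtain ⟨x, hx, hax⟩ := hk a b
      obtain ⟨y, hy, hvy⟩ := hθ.exists_infix_of_mem hax hv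
      exact ⟨y, realPow_add hx hy, huv.trans hvy⟩
    · obtain ⟨x, hx⟩ := hθ.realPow_nonempty j [b]
      obtain ⟨e, x', rfl⟩ := List.exists_cons_of_ne_nil (hθ.ne_nil_of_mem_realPow hx)
      obtain ⟨y, hy, hcy⟩ := hk c e
      obtain ⟨z, hz, hyz⟩ := hθ.exists_infix_of_mem (List.mem_cons_self (l := x')) hy
      refine ⟨z, ?_, (List.singleton_infix_iff _ _).2 (hyz.subset hcy)⟩
      rw [Nat.add_comm]
      exact realPow_add hx hz
  obtain ⟨n, hn⟩ := hθ.exists_realPow_length_ge hprim hne (ts.length + 2)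
  refine ⟨n + (k + j), fun b => ?_⟩
  obtain ⟨w, hw, hlen⟩ := hn b
  obtain ⟨x, w, rfl⟩ := List.exists_cons_of_ne_nil (hθ.ne_nil_of_mem_realPow hw)
  obtain ⟨w, y, rfl⟩ := w.eq_nil_or_concat.resolve_left (by rintro rfl; simp at hlen)
  obtain ⟨m, hm, hmts⟩ := hθ.exists_forall_infix_realPow (w := w) hocc (by simpa using hlen)
  obtain ⟨p, hp⟩ := hθ.realPow_nonempty (k + j) [x]
  obtain ⟨s, hs⟩ := hθ.realPow_nonempty (k + j) [y]
  refine ⟨p, m, s, realPow_add hw ?_, hθ.ne_nil_of_mem_realPow hp, hθ.ne_nil_of_mem_realPow hs,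
    hmts u (by simp [hts]), fun c => (List.singleton_infix_iff _ _).1 (hmts [c] (by simp [hts]))⟩
  rw [List.append_assoc, List.concat_eq_append]
  exact realPow_append (w₁ := [x]) hp (realPow_append hm hs)

end Realisations

section Deterministic

variable {φ : A → List A}

theorem detApply_append (v w : List A) : detApply φ (v ++ w) = detApply φ v ++ detApply φ w := by
  simp [detApply]

theorem detApply_singleton (a : A) : detApply φ [a] = φ a := by
  simp [detApply]

theorem iterate_detApply_append (n : ℕ) (v w : List A) :
    (detApply φ)^[n] (v ++ w) = (detApply φ)^[n] v ++ (detApply φ)^[n] w := by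
  induction n generalizing v w with
  | zero => rfl
  | succ n ih => simp only [Function.iterate_succ_apply, detApply_append, ih]

theorem iterate_detApply_ne_nil (hφ : ∀ a, φ a ≠ []) (n : ℕ) {w : List A} (hw : w ≠ []) :
    (detApply φ)^[n] w ≠ [] := by
  induction n generalizing w with
  | zero => exact hw
  | succ n ih =>
    rw [Function.iterate_succ_apply]
    obtain ⟨a, w, rfl⟩ := List.exists_cons_of_ne_nil hw
    exact ih (by simp [detApply, hφ a])

theorem detApply_mem_realPow {θ : A → Set (List A)} {n : ℕ} (h : ∀ a, φ a ∈ realPow θ n [a])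
    (w : List A) : detApply φ w ∈ realPow θ n w := by
  induction w with
  | nil => exact nil_mem_realPow n
  | cons a w ih =>
    rw [← List.singleton_append, detApply_append, detApply_singleton]
    exact realPow_append (h a) ih

theorem iterate_detApply_mem_realPow {θ : A → Set (List A)} {n : ℕ}
    (h : ∀ a, φ a ∈ realPow θ n [a]) (i : ℕ) (w : List A) :
    (detApply φ)^[i] w ∈ realPow θ (n * i) w := by
  induction i generalizing w with
  | zero => rfl
  | succ i ih =>
    rw [Function.iterate_succ_apply, Nat.mul_succ, Nat.add_comm]
    exact realPow_add (detApply_mem_realPow h w) (ih _)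

theorem Xdet_subset_X {θ : A → Set (List A)} {n : ℕ} (h : ∀ a, φ a ∈ realPow θ n [a]) :
    Xdet φ ⊆ X θ := fun x hx i m => by
  obtain ⟨k, a, hka⟩ := hx i m
  exact ⟨n * k, a, _, iterate_detApply_mem_realPow h k [a], hka⟩

end Deterministic

section Sequences

@[simp]
theorem length_subwordAt (x : ℤ → A) (i : ℤ) (n : ℕ) : (subwordAt x i n).length = n := by
  simp [subwordAt]

theorem subwordAt_add (x : ℤ → A) (i : ℤ) (m n : ℕ) :
    subwordAt x i (m + n) = subwordAt x i m ++ subwordAt x (i + m) n := by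
  simp [subwordAt, List.ofFn_add, add_assoc]

theorem infix_subwordAt_of_le (x : ℤ → A) {i j : ℤ} {m n : ℕ} (hij : i ≤ j) (hjn : j + n ≤ i + m) :
    subwordAt x j n <:+: subwordAt x i m := by
  obtain ⟨k, rfl⟩ := Int.le.dest hij
  obtain ⟨l, rfl⟩ : ∃ l, m = k + n + l := Nat.exists_eq_add_of_le (by omega)
  rw [subwordAt_add, subwordAt_add]
  exact ⟨_, _, rfl⟩

theorem exists_subwordAt_eq {x : ℤ → A} {i : ℤ} {n : ℕ} {u : List A}
    (h : u <:+: subwordAt x i n) : ∃ j, subwordAt x j u.length = u := by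
  obtain ⟨s, t, h⟩ := h
  have hn : n = s.length + u.length + t.length := by
    simpa [Nat.add_assoc] using (congrArg List.length h).symm
  rw [hn, subwordAt_add, subwordAt_add] at h
  have h₁ := List.append_inj h.symm (by simp)
  exact ⟨_, (List.append_inj h₁.1 (by simp)).2⟩

theorem subwordAt_translate (x : ℤ → A) (c i : ℤ) (n : ℕ) :
    subwordAt (fun z => x (z + c)) i n = subwordAt x (i + c) n := by
  simp only [subwordAt, add_right_comm]

theorem eq_of_subwordAt_eq {x y : ℤ → A} {i : ℤ} {n : ℕ} (h : subwordAt x i n = subwordAt y i n)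
    {z : ℤ} (hz : i ≤ z) (hzn : z < i + n) : x z = y z := by
  obtain ⟨k, rfl⟩ := Int.le.dest hz
  exact congrFun (List.ofFn_injective h) ⟨k, by omega⟩

/-- A sequence of words, each of which extends the previous one strictly on both sides, has a
bi-infinite limit. -/
theorem exists_limit {w p s : ℕ → List A} (h₀ : w 0 ≠ [])
    (hw : ∀ i, w (i + 1) = p i ++ w i ++ s i) (hp : ∀ i, p i ≠ []) (hs : ∀ i, s i ≠ []) :
    ∃ (x : ℤ → A) (o : ℕ → ℕ), ∀ i, subwordAt x (-o i) (w i).length = w i ∧ i ≤ o i ∧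
      o i + i < (w i).length := by
  set o : ℕ → ℕ := fun i => ∑ j ∈ Finset.range i, (p j).length with ho
  have ho_succ : ∀ i, o (i + 1) = o i + (p i).length := fun i => Finset.sum_range_succ _ _
  have hbound : ∀ i, i ≤ o i ∧ o i + i < (w i).length := by
    intro i
    induction i with
    | zero => simpa [ho] using List.length_pos_iff.2 h₀
    | succ i ih =>
      have h₁ := List.length_pos_iff.2 (hp i)
      have h₂ := List.length_pos_iff.2 (hs i)
      rw [ho_succ, hw]
      simp only [List.length_append]
      omega
  have hstable : ∀ (z : ℤ) (i j : ℕ), i ≤ j → 0 ≤ o i + z → o i + z < (w i).length →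
      0 ≤ o j + z ∧ o j + z < (w j).length ∧ (w j)[(o j + z).toNat]? = (w i)[(o i + z).toNat]? := by
    intro z i j hij h₁ h₂
    induction j, hij using Nat.le_induction with
    | base => exact ⟨h₁, h₂, rfl⟩
    | succ j _ ih =>
      obtain ⟨h₃, h₄, h₅⟩ := ih
      have hn : (o (j + 1) + z).toNat = (p j).length + (o j + z).toNat := by
        rw [ho_succ]; omega
      refine ⟨by rw [ho_succ]; omega, ?_, ?_⟩
      · rw [ho_succ, hw]
        simp only [List.length_append]
        omega
      · rw [hn, ← h₅, hw, List.append_assoc, List.getElem?_append_right (Nat.le_add_right _ _),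
          Nat.add_sub_cancel_left, List.getElem?_append_left (by omega)]
  have hlt : ∀ z : ℤ, (o z.natAbs + z).toNat < (w z.natAbs).length := fun z => by
    have := hbound z.natAbs
    omega
  refine ⟨fun z => (w z.natAbs)[(o z.natAbs + z).toNat]'(hlt z), o, fun i => ⟨?_, hbound i⟩⟩
  refine List.ext_getElem (by simp) fun n _ hn => ?_
  simp only [subwordAt, List.getElem_ofFn]
  apply Option.some_injective
  rw [← List.getElem?_eq_getElem, ← List.getElem?_eq_getElem]
  set z : ℤ := -o i + n with hz
  have hb := hbound z.natAbs
  have h₁ := (hstable z z.natAbs _ (le_max_left _ i) (by omega) (by omega)).2.2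
  have h₂ := (hstable z i _ (le_max_right z.natAbs i) (by omega) (by omega)).2.2
  rw [← h₁, h₂]
  congr 1
  omega

end Sequences

/-- A word in `φ a` occurs in a point of the subshift of `φ`, provided that `a` occurs in the
interior of `φ a`. -/
theorem exists_mem_Xdet {φ : A → List A} (hφ : ∀ a, φ a ≠ []) {a : A} {p s u : List A}
    (ha : φ a = p ++ [a] ++ s) (hp : p ≠ []) (hs : s ≠ []) (hu : u <:+: φ a) (i : ℤ) :
    ∃ x ∈ Xdet φ, subwordAt x i u.length = u := by
  obtain ⟨x, o, hx⟩ := exists_limit (w := fun n => (detApply φ)^[n] [a])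
    (p := fun n => (detApply φ)^[n] p) (s := fun n => (detApply φ)^[n] s) (by simp)
    (fun n => by
      simp only [Function.iterate_succ_apply, detApply_singleton, ha, iterate_detApply_append])
    (fun n => iterate_detApply_ne_nil hφ n hp) (fun n => iterate_detApply_ne_nil hφ n hs)
  have hmem : ∀ (j : ℤ) (n : ℕ), ∃ k, subwordAt x j n <:+: (detApply φ)^[k] [a] := by
    intro j n
    obtain ⟨h₁, h₂, h₃⟩ := hx (j.natAbs + n)
    refine ⟨j.natAbs + n, ?_⟩
    rw [← h₁]
    exact infix_subwordAt_of_le x (by omega) (by omega)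
  have hu' : u <:+: subwordAt x (-o 1) ((detApply φ)^[1] [a]).length := by
    rw [(hx 1).1, Function.iterate_one, detApply_singleton]
    exact hu
  obtain ⟨j, hj⟩ := exists_subwordAt_eq hu'
  refine ⟨fun z => x (z + (j - i)), fun l n => ?_, ?_⟩
  · obtain ⟨k, hk⟩ := hmem (l + (j - i)) n
    exact ⟨k, a, by rwa [subwordAt_translate]⟩
  · rw [subwordAt_translate, add_sub_cancel, hj]

/-- A family of points realising all finite windows of `x` accumulates at `x`. -/
theorem mem_closure_of_subwordAt [TopologicalSpace A] [DiscreteTopology A] {S : Set (ℤ → A)}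
    {x : ℤ → A} (h : ∀ i n, ∃ y ∈ S, subwordAt y i n = subwordAt x i n) : x ∈ closure S := by
  refine mem_closure_iff.2 fun U hU hxU => ?_
  obtain ⟨I, t, ht, hIU⟩ := isOpen_pi_iff.1 hU x hxU
  set N : ℕ := I.sup Int.natAbs with hN
  obtain ⟨y, hyS, hy⟩ := h (-N) (2 * N + 1)
  refine ⟨y, hIU fun z hz => ?_, hyS⟩
  have hzN : z.natAbs ≤ N := Finset.le_sup (f := Int.natAbs) hz
  rw [eq_of_subwordAt_eq hy (by omega) (by omega)]
  exact (ht z hz).2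

end RS

/-- For a primitive random substitution with nonempty RS-subshift, the union of
all substitutive subspaces of the RS-subshift is dense in it. -/
theorem stmt4 {A : Type*} [Fintype A] [TopologicalSpace A] [DiscreteTopology A]
    (θ : A → Set (List A)) (hrs : RS.IsRandomSubst θ) (hprim : RS.Primitive θ)
    (hne : (RS.X θ).Nonempty) :
    RS.X θ ⊆ closure (⋃₀ {Y : Set (ℤ → A) | RS.Substitutive Y ∧ Y ⊆ RS.X θ}) := by
  intro x hx
  refine RS.mem_closure_of_subwordAt fun i n => ?_
  obtain ⟨N, hN⟩ := hrs.exists_realPow_interior hprim hne (hx i n)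
  choose p m s hmem hp hs hu hm using hN
  set φ : A → List A := fun b => p b ++ m b ++ s b with hφ
  have hφ_ne : ∀ a, φ a ≠ [] := fun a => by simp [hφ, hp a]
  have hφ_prim : RS.DetPrimitive φ := ⟨1, fun a b => by
    simp [RS.detApply_singleton, hφ, hm a b]⟩
  obtain ⟨q, r, hqr⟩ := List.append_of_mem (hm (x 0) (x 0))
  obtain ⟨y, hy, hyu⟩ := RS.exists_mem_Xdet (a := x 0) (p := p (x 0) ++ q) (s := r ++ s (x 0))
    hφ_ne (by simp [hφ, hqr]) (by simp [hp]) (by simp [hs])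
    ((hu (x 0)).trans ⟨p (x 0), s (x 0), rfl⟩) i
  rw [RS.length_subwordAt] at hyu
  exact ⟨y, ⟨RS.Xdet φ, ⟨⟨φ, hφ_ne, hφ_prim, rfl⟩, RS.Xdet_subset_X hmem⟩, hy⟩, hyu⟩
end

section
/- Let G be a strongly connected finite directed graph with vertex set {v_a : a ∈ 𝒜} indexed by a finite alphabet 𝒜, and let θ_G be the associated cycle-substitution. Then for every cycle γ in G rooted at the vertex v_a there exists k ≥ 1 such that the word read u(γ) is a realisation of θ_G^k(a), i.e. u(γ) ∈ θ_G^k(a); in particular u(γ) is θ_G-legal. -/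
namespace RS

variable {A : Type*}

theorem mem_real_singletons (θ : A → Set (List A)) (hθ : ∀ a, [a] ∈ θ a) (w : List A) :
    w ∈ real θ w := by
  induction w with
  | nil => exact rfl
  | cons a w ih => exact ⟨[a], hθ a, w, ih, rfl⟩

theorem append_mem_real {θ : A → Set (List A)} {u v u' v' : List A}
    (hu : u' ∈ real θ u) (hv : v' ∈ real θ v) : u' ++ v' ∈ real θ (u ++ v) := by
  induction u generalizing u' with
  | nil =>
    obtain rfl : u' = [] := hu
    exact hv
  | cons a u ih =>
    obtain ⟨x, hx, r, hr, rfl⟩ := hu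
    exact ⟨x, hx, r ++ v', ih hr, List.append_assoc _ _ _⟩

theorem mem_realPow_succ {θ : A → Set (List A)} {k : ℕ} {u v w : List A}
    (hv : v ∈ realPow θ k u) (hw : w ∈ real θ v) : w ∈ realPow θ (k + 1) u := by
  induction k generalizing u with
  | zero =>
    obtain rfl : v = u := hv
    exact Set.mem_biUnion hw rfl
  | succ k ih =>
    obtain ⟨x, hx, hvx⟩ := Set.mem_iUnion₂.1 hv
    exact Set.mem_biUnion hx (ih hvx)

theorem singleton_mem_cycleSubst (E : Set (A × A)) (a : A) : [a] ∈ cycleSubst E a :=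
  Or.inl rfl

/-- Replacing one letter of a word by one of its realisations. -/
theorem replace_mem_real {θ : A → Set (List A)} (hθ : ∀ a, [a] ∈ θ a) {x : A} {u : List A}
    (hu : u ∈ θ x) (p r : List A) : p ++ (u ++ r) ∈ real θ (p ++ x :: r) :=
  append_mem_real (mem_real_singletons θ hθ p) ⟨u, hu, r, mem_real_singletons θ hθ r, rfl⟩

/-- A list with a repetition contains a repetition whose period has no repetition. -/
theorem exists_first_return {l : List A} (h : ¬ l.Nodup) :
    ∃ p x q r, l = p ++ (x :: q ++ x :: r) ∧ (x :: q).Nodup := by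
  induction l with
  | nil => exact absurd List.nodup_nil h
  | cons y l ih =>
    by_cases hl : l.Nodup
    · have hy : y ∈ l := by
        by_contra hy
        exact h (List.nodup_cons.2 ⟨hy, hl⟩)
      obtain ⟨q, r, rfl⟩ := List.append_of_mem hy
      refine ⟨[], y, q, r, rfl, List.nodup_cons.2 ⟨fun hq => ?_, hl.of_append_left⟩⟩
      exact List.disjoint_of_nodup_append hl hq List.mem_cons_self
    · obtain ⟨p, x, q, r, rfl, hq⟩ := ih hl
      exact ⟨y :: p, x, q, r, rfl, hq⟩

theorem exists_path_of_isChain (E : Set (A × A)) (m : List A) (a b : A)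
    (h : (a :: m ++ [b]).IsChain fun x y => (x, y) ∈ E) :
    ∃ γ, IsPath E γ ∧ src γ = some a ∧ tgt γ = some b ∧ γ.map Prod.fst = a :: m := by
  induction m generalizing a with
  | nil =>
    have hab : (a, b) ∈ E := by simpa using h
    exact ⟨[(a, b)], ⟨by simp, by simpa using hab, List.isChain_singleton _⟩, rfl, rfl, rfl⟩
  | cons c m ih =>
    obtain ⟨hac, hc⟩ := List.isChain_cons_cons.1 h
    obtain ⟨_ | ⟨e, γ⟩, ⟨hne, hE, hch⟩, hs, ht, hm⟩ := ih c hc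
    · exact absurd rfl hne
    · have hce : e.1 = c := by simpa [src] using hs
      refine ⟨(a, c) :: e :: γ, ⟨by simp, ?_, ?_⟩, rfl, ?_, ?_⟩
      · exact List.forall_mem_cons.2 ⟨hac, hE⟩
      · exact List.isChain_cons_cons.2 ⟨hce.symm, hch⟩
      · simpa [tgt] using ht
      · simpa using hm

theorem isChain_of_isPath (E : Set (A × A)) (γ : List (A × A)) (b : A) (h : IsPath E γ)
    (ht : tgt γ = some b) :
    (γ.map Prod.fst ++ [b]).IsChain fun x y => (x, y) ∈ E := by
  obtain ⟨hne, hE, hch⟩ := h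
  induction γ with
  | nil => exact absurd rfl hne
  | cons e γ ih =>
    obtain ⟨he, hE⟩ := List.forall_mem_cons.1 hE
    cases γ with
    | nil =>
      obtain rfl : e.2 = b := by simpa [tgt] using ht
      simpa using he
    | cons f γ =>
      obtain ⟨hef, hch⟩ := List.isChain_cons_cons.1 hch
      exact List.isChain_cons_cons.2
        ⟨by simpa [← hef] using he, ih (by simpa [tgt] using ht) (by simp) hE hch⟩

theorem mem_cycleSubst_of_nodup (E : Set (A × A)) (a : A) (m : List A)
    (h : (a :: m ++ [a]).IsChain fun x y => (x, y) ∈ E) (hm : (a :: m).Nodup) :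
    a :: m ++ [a] ∈ cycleSubst E a := by
  obtain ⟨γ, hγ, hs, ht, hw⟩ := exists_path_of_isChain E m a a h
  refine Or.inr ⟨γ, ⟨hγ, hs.trans ht.symm⟩, ?_, hs, ?_⟩
  · rwa [IsSimple, hw]
  · rw [wordRead, hw, hs, Option.toList_some]

theorem exists_mem_realPow_of_isChain (E : Set (A × A)) (a : A) (m : List A)
    (h : (a :: m ++ [a]).IsChain fun x y => (x, y) ∈ E) :
    ∃ k, 1 ≤ k ∧ a :: m ++ [a] ∈ realPow (cycleSubst E) k [a] := by
  by_cases hm : (a :: m).Nodup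
  · refine ⟨1, le_rfl, mem_realPow_succ (v := [a]) rfl ?_⟩
    simpa using replace_mem_real (singleton_mem_cycleSubst E)
      (mem_cycleSubst_of_nodup E a m h hm) [] []
  · obtain ⟨p, x, q, r, hl, hq⟩ := exists_first_return hm
    have hw : a :: m ++ [a] = p ++ ((x :: q ++ [x]) ++ (r ++ [a])) := by simp [hl]
    rw [hw] at h ⊢
    obtain ⟨m', hm'⟩ : ∃ m', p ++ x :: r = a :: m' := by
      cases p with
      | nil => exact ⟨r, by simp_all⟩
      | cons y p => exact ⟨p ++ x :: r, by simp_all⟩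
    have hlen : m'.length < m.length := by
      have h₁ := congrArg List.length hl
      have h₂ := congrArg List.length hm'
      simp only [List.length_append, List.length_cons] at h₁ h₂
      omega
    have hcyc : (x :: q ++ [x]).IsChain fun x y => (x, y) ∈ E :=
      h.right_of_append.left_of_append
    have hshort : (a :: m' ++ [a]).IsChain fun x y => (x, y) ∈ E := by
      rw [← hm', List.append_assoc]
      have h₁ : (p ++ [x]).IsChain fun x y => (x, y) ∈ E :=
        List.IsChain.left_of_append (l₂ := q ++ [x] ++ (r ++ [a])) (by simpa using h)
      have h₂ : ([x] ++ (r ++ [a])).IsChain fun x y => (x, y) ∈ E :=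
        List.IsChain.right_of_append (l₁ := p ++ x :: q) (by simpa using h)
      simpa using h₁.append_overlap h₂ (by simp)
    obtain ⟨k, -, hk⟩ := exists_mem_realPow_of_isChain E a m' hshort
    refine ⟨k + 1, by omega, mem_realPow_succ hk ?_⟩
    rw [← hm', List.append_assoc]
    exact replace_mem_real (singleton_mem_cycleSubst E) (mem_cycleSubst_of_nodup E x q hcyc hq)
      p (r ++ [a])
termination_by m.length

end RS

/-- For every cycle `γ` rooted at the vertex `a` of a strongly connected graph,
there is a `k ≥ 1` such that the word read of `γ` is a realisation of the `k`-th power of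
the cycle-substitution on `a`; in particular the word read of `γ` is legal. -/
theorem stmt7 {A : Type*} [Fintype A] (E : Set (A × A))
    (hsc : RS.StronglyConnected E) (a : A) (γ : List (A × A))
    (hγ : RS.IsCycle E γ) (hroot : RS.src γ = some a) :
    (∃ k : ℕ, 1 ≤ k ∧ RS.wordRead γ ∈ RS.realPow (RS.cycleSubst E) k [a]) ∧
      RS.Legal (RS.cycleSubst E) (RS.wordRead γ) := by
  have key : ∃ k : ℕ, 1 ≤ k ∧ RS.wordRead γ ∈ RS.realPow (RS.cycleSubst E) k [a] := by
    have hch := RS.isChain_of_isPath E γ a hγ.1 (hγ.2.symm.trans hroot)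
    obtain ⟨m, hm⟩ : ∃ m, γ.map Prod.fst = a :: m := by
      cases γ with
      | nil => exact absurd rfl hγ.1.1
      | cons e γ => exact ⟨γ.map Prod.fst, by simpa [RS.src] using hroot⟩
    rw [RS.wordRead, hroot, Option.toList_some, hm]
    exact RS.exists_mem_realPow_of_isChain E a m (hm ▸ hch)
  obtain ⟨k, hk, hmem⟩ := key
  exact ⟨⟨k, hk, hmem⟩, k, a, _, hmem, List.infix_rfl⟩
end
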